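/- arXiv:2410.16495 — 2 statements merged into one kernel-verified Lean document; each statement's English description precedes it below -/
import Mathlib

section
/- Let 𝔠 be an ample interrupted constellation. Then 𝔠 has no induced subgraph isomorphic to any of the following: (i) an ample q-zigzagged (3q+6, 6·C(q+2,3))-constellation, for any positive integer q (where C(q+2,3) is the binomial coefficient); (ii) a subdivision of the full binary tree T_7 or the line graph of a subdivision of T_7; (iii) a subdivision of the wall W_{6×6} or the line graph of a subdivision of W_{6×6}. -/
open SimpleGraph

/-- Two vertex sets `X` and `Y` are *anticomplete* in `G` if they are disjoint and
there is no edge of `G` with an end in each. -/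
def Anticomplete {V : Type} (G : SimpleGraph V) (X Y : Set V) : Prop :=
  Disjoint X Y ∧ ∀ x ∈ X, ∀ y ∈ Y, ¬ G.Adj x y

/-- `G` has an induced subgraph isomorphic to `H`. -/
def HasInducedSubgraphIso {V W : Type} (G : SimpleGraph V) (H : SimpleGraph W) : Prop :=
  ∃ X : Set V, Nonempty (H ≃g G.induce X)

/-- `G` has an induced minor isomorphic to `H`, witnessed by branch sets. -/
def HasInducedMinor {V W : Type} (G : SimpleGraph V) (H : SimpleGraph W) : Prop :=
  ∃ B : W → Set V,
    (∀ w, (G.induce (B w)).Connected) ∧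
    (Pairwise fun u v => Disjoint (B u) (B v)) ∧
    (∀ u v : W, u ≠ v → (H.Adj u v ↔ ¬ Anticomplete G (B u) (B v)))

/-- The set `P` induces a path in `G`. -/
def IsPathSet {V : Type} (G : SimpleGraph V) (P : Set V) : Prop :=
  ∃ n : ℕ, Nonempty (G.induce P ≃g pathGraph (n + 1))

/-- The vertex sets of the connected components of the subgraph of `G` induced on `X`. -/
def CompsOn {V : Type} (G : SimpleGraph V) (X : Set V) : Set (Set V) :=
  {L | ∃ C : (G.induce X).ConnectedComponent, L = Subtype.val '' C.supp}

/-- The induced subgraph of `G` on `W` together with the stable set `S ⊆ W` forms a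
constellation: every component of `W \ S` is a path and every vertex of `S` has a
neighbor in every such component. -/
structure IsConstellationOn {V : Type} (G : SimpleGraph V) (W S : Set V) : Prop where
  subset : S ⊆ W
  stable : ∀ x ∈ S, ∀ y ∈ S, ¬ G.Adj x y
  comp_paths : ∀ L ∈ CompsOn G (W \ S), IsPathSet G L
  dominates : ∀ x ∈ S, ∀ L ∈ CompsOn G (W \ S), ∃ y ∈ L, G.Adj x y

/-- `p` is a route of the constellation `(W, S)` in `G`: an induced path of the induced
subgraph of `G` on `W`, with its two (distinct) ends in `S` and its interior outside `S`. -/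
structure IsRoute {V : Type} (G : SimpleGraph V) (W S : Set V) {x y : V}
    (p : G.Walk x y) : Prop where
  ne : x ≠ y
  isPath : p.IsPath
  induced : ∀ u v, u ∈ p.support → v ∈ p.support → G.Adj u v → p.toSubgraph.Adj u v
  support_mem : ∀ v ∈ p.support, v ∈ W
  fst_mem : x ∈ S
  snd_mem : y ∈ S
  interior : ∀ v ∈ p.support, v ≠ x → v ≠ y → v ∉ S

/-- The constellation `(W, S)` in `G` is `d`-ample: no route has length at most `d+1`. -/
def DAmple {V : Type} (G : SimpleGraph V) (W S : Set V) (d : ℕ) : Prop :=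
  ∀ ⦃x y : V⦄ (p : G.Walk x y), IsRoute G W S p → d + 1 < p.length

/-- The constellation `(W, S)` in `G` is interrupted with respect to some linear order
(encoded by an injective-on-`S` function `f : V → ℕ`). -/
def Interrupted {V : Type} (G : SimpleGraph V) (W S : Set V) : Prop :=
  ∃ f : V → ℕ, Set.InjOn f S ∧
    ∀ x ∈ S, ∀ y ∈ S, ∀ z ∈ S, f x < f y → f y < f z →
      ∀ (p : G.Walk x y), IsRoute G W S p → ∃ v ∈ p.support, G.Adj z v

/-- The constellation `(W, S)` in `G` is `q`-zigzagged. -/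
def Zigzagged {V : Type} (G : SimpleGraph V) (W S : Set V) (q : ℕ) : Prop :=
  ∃ f : V → ℕ, Set.InjOn f S ∧
    ∀ x ∈ S, ∀ y ∈ S, f x < f y →
      ∀ (p : G.Walk x y), IsRoute G W S p →
        {z | z ∈ S ∧ f x < f z ∧ f z < f y ∧ ¬ ∃ v ∈ p.support, G.Adj z v}.ncard < q

/-- The constellation `(W, S)` in `G` is `(qm, q, qp)`-mixed. -/
def Mixed {V : Type} (G : SimpleGraph V) (W S : Set V) (qm q qp : ℕ) : Prop :=
  ∃ f : V → ℕ, Set.InjOn f S ∧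
    ∀ x ∈ S, ∀ y ∈ S, f x < f y →
      ∀ (p : G.Walk x y), IsRoute G W S p →
        ∀ Qm Q Qp : Set V, Qm ⊆ S → Q ⊆ S → Qp ⊆ S →
          Qm.ncard = qm → Q.ncard = q → Qp.ncard = qp →
          (∀ z ∈ Qm, f z < f x) → (∀ z ∈ Q, f x < f z ∧ f z < f y) →
          (∀ z ∈ Qp, f y < f z) →
          ∃ z ∈ Qm ∪ Q ∪ Qp, ∃ v ∈ p.support, G.Adj z v

/-- The constellation `(W', S')` sits in the constellation `(W, S)` (both within `G`). -/
def SitsIn {V : Type} (G : SimpleGraph V) (W' S' W S : Set V) : Prop :=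
  W' ⊆ W ∧ S' ⊆ S ∧
  (∀ L ∈ CompsOn G (W' \ S'), ∃ M ∈ CompsOn G (W \ S), L ⊆ M) ∧
  (∀ M ∈ CompsOn G (W \ S), ∀ L₁ ∈ CompsOn G (W' \ S'), ∀ L₂ ∈ CompsOn G (W' \ S'),
      L₁ ⊆ M → L₂ ⊆ M → L₁ = L₂)

/-- A witness that `S` is a subdivision of `H`, where each edge of `H` is replaced by a
path whose length satisfies `ok`. -/
structure SubdivModel {U W : Type} (S : SimpleGraph U) (H : SimpleGraph W)
    (ok : ℕ → Prop) where
  b : W → U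
  b_inj : Function.Injective b
  path : ∀ ⦃u v : W⦄, H.Adj u v → S.Walk (b u) (b v)
  path_isPath : ∀ ⦃u v : W⦄ (h : H.Adj u v), (path h).IsPath
  path_len : ∀ ⦃u v : W⦄ (h : H.Adj u v), ok (path h).length
  path_symm : ∀ ⦃u v : W⦄ (h : H.Adj u v), path h.symm = (path h).reverse
  branch_avoid : ∀ ⦃u v : W⦄ (h : H.Adj u v) (w : W), b w ∈ (path h).support → w = u ∨ w = v
  interiors_anticomplete :
    ∀ ⦃u v u' v' : W⦄ (h : H.Adj u v) (h' : H.Adj u' v'),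
      (s(u, v) : Sym2 W) ≠ s(u', v') →
      ∀ x ∈ (path h).support, x ≠ b u → x ≠ b v →
      ∀ y ∈ (path h').support, y ≠ b u' → y ≠ b v' →
        x ≠ y ∧ ¬ S.Adj x y
  cover : ∀ x : U, (∃ w, x = b w) ∨ ∃ (u v : W) (h : H.Adj u v), x ∈ (path h).support
  edges_eq : ∀ x y : U, S.Adj x y → ∃ (u v : W) (h : H.Adj u v), (path h).toSubgraph.Adj x y

/-- `S` is a subdivision of `H` with path lengths satisfying `ok`. -/
def IsSubdivisionWith {U W : Type} (S : SimpleGraph U) (H : SimpleGraph W)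
    (ok : ℕ → Prop) : Prop :=
  Nonempty (SubdivModel S H ok)

/-- The line graph of `G`. -/
def LineGraph {V : Type} (G : SimpleGraph V) : SimpleGraph G.edgeSet :=
  SimpleGraph.fromRel (fun e f => ∃ v : V, v ∈ (e : Sym2 V) ∧ v ∈ (f : Sym2 V))

/-- The `r`-by-`r` hexagonal wall (brick wall). -/
def Wall (r : ℕ) : SimpleGraph (Fin r × Fin (2 * r)) :=
  SimpleGraph.fromRel (fun a b =>
    (a.1 = b.1 ∧ a.2.val + 1 = b.2.val) ∨
    (a.2 = b.2 ∧ a.1.val + 1 = b.1.val ∧ (a.1.val + a.2.val) % 2 = 0))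

/-- The full binary tree of radius `r`, on `2^(r+1) - 1` vertices (heap indexing). -/
def BinTree (r : ℕ) : SimpleGraph (Fin (2 ^ (r + 1) - 1)) :=
  SimpleGraph.fromRel (fun a b =>
    b.val + 1 = 2 * (a.val + 1) ∨ b.val + 1 = 2 * (a.val + 1) + 1)

/-- The leaf-extension of `H` by leaves `L` attached via `f`. -/
def leafExt {W : Type} (H : SimpleGraph W) (L : Type) (f : L → W) :
    SimpleGraph (W ⊕ L) :=
  SimpleGraph.fromRel (fun a b =>
    match a, b with
    | Sum.inl a, Sum.inl b => H.Adj a b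
    | Sum.inl a, Sum.inr x => f x = a
    | _, _ => False)

/-- `G` has treewidth at most `k` (via tree decompositions). -/
def TreewidthLE {V : Type} (G : SimpleGraph V) (k : ℕ) : Prop :=
  ∃ (ι : Type) (T : SimpleGraph ι) (bag : ι → Set V),
    T.IsTree ∧
    (∀ v, ∃ i, v ∈ bag i) ∧
    (∀ u v, G.Adj u v → ∃ i, u ∈ bag i ∧ v ∈ bag i) ∧
    (∀ v, (T.induce {i | v ∈ bag i}).Connected) ∧
    (∀ i, (bag i).ncard ≤ k + 1)

/-- `G` has pathwidth at most `k` (via path decompositions). -/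
def PathwidthLE {V : Type} (G : SimpleGraph V) (k : ℕ) : Prop :=
  ∃ (n : ℕ) (bag : Fin n → Set V),
    (∀ v, ∃ i, v ∈ bag i) ∧
    (∀ u v, G.Adj u v → ∃ i, u ∈ bag i ∧ v ∈ bag i) ∧
    (∀ (v : V) (i j k' : Fin n), i ≤ j → j ≤ k' → v ∈ bag i → v ∈ bag k' → v ∈ bag j) ∧
    (∀ i, (bag i).ncard ≤ k + 1)

/-- An induced `(s,t)`-model in `G`. -/
def IsInducedModel {V : Type} (G : SimpleGraph V) {s t : ℕ}
    (A : Fin s → Set V) (B : Fin t → Set V) : Prop :=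
  (∀ i, (G.induce (A i)).Connected) ∧
  (∀ j, (G.induce (B j)).Connected) ∧
  (∀ i j : Fin s, i ≠ j → Anticomplete G (A i) (A j)) ∧
  (∀ i j : Fin t, i ≠ j → Anticomplete G (B i) (B j)) ∧
  (∀ (i : Fin s) (j : Fin t), Disjoint (A i) (B j) ∧ ¬ Anticomplete G (A i) (B j))

/-- The `A`-contraction of a model: each `A i` is contracted to the vertex `Sum.inl i`. -/
def AContraction {V : Type} (G : SimpleGraph V) {s t : ℕ}
    (A : Fin s → Set V) (B : Fin t → Set V) :
    SimpleGraph (Fin s ⊕ (⋃ j, B j : Set V)) :=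
  SimpleGraph.fromRel (fun x y =>
    match x, y with
    | Sum.inl i, Sum.inl i' => i ≠ i' ∧ ∃ a ∈ A i, ∃ a' ∈ A i', G.Adj a a'
    | Sum.inl i, Sum.inr b => ∃ a ∈ A i, G.Adj a ↑b
    | Sum.inr b, Sum.inr b' => G.Adj ↑b ↑b'
    | _, _ => False)

/-- A linear induced model is `d`-`A`-ample if its `A`-contraction is `d`-ample. -/
def ModelAAmple {V : Type} (G : SimpleGraph V) {s t : ℕ}
    (A : Fin s → Set V) (B : Fin t → Set V) (d : ℕ) : Prop :=
  DAmple (AContraction G A B) Set.univ (Set.range Sum.inl) d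

/-- A linear induced model is `d`-ample if it is `d`-`A`-ample and `d`-`B`-ample. -/
def ModelAmple {V : Type} (G : SimpleGraph V) {s t : ℕ}
    (A : Fin s → Set V) (B : Fin t → Set V) (d : ℕ) : Prop :=
  ModelAAmple G A B d ∧ ModelAAmple G B A d

/-- The zigzag sequences. -/
def Zseq : ℕ → List ℤ
  | 0 => []
  | 1 => [1]
  | 2 => [1, 2]
  | 3 => [1, 2, 3]
  | n + 4 =>
      (Zseq (n + 3)).dropLast ++ (((Zseq (n + 2)).map (· + 1)).reverse).dropLast
        ++ (Zseq (n + 3)).map (· + 1)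

/-- Collapse each maximal run of consecutive equal entries to a single entry. -/
def collapse (l : List ℤ) : List ℤ := l.destutter (· ≠ ·)

/-- `B` is an alignment in the sequence `A`. -/
def IsAlignment (A : List ℤ) (B : Finset ℤ) : Prop :=
  (∀ b ∈ B, b ∈ A) ∧
  ∃ i j : ℕ, i ≤ j ∧ j < A.length ∧
    ∀ b ∈ B,
      (collapse (((A.take (j + 1)).drop i).filter (fun a => decide (a ∈ B)))).count b = 1

/-- `x` and `y` are joined by a walk of `G` all of whose vertices lie in `A`. -/
def ReachIn {V : Type} (G : SimpleGraph V) (A : Set V) (x y : V) : Prop :=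
  ∃ p : G.Walk x y, ∀ v ∈ p.support, v ∈ A

namespace ReachIn

variable {V : Type} {G : SimpleGraph V} {A B : Set V} {x y z : V}

lemma refl (hx : x ∈ A) : ReachIn G A x x := ⟨.nil, by simpa using hx⟩

lemma symm (h : ReachIn G A x y) : ReachIn G A y x := by
  obtain ⟨p, hp⟩ := h
  exact ⟨p.reverse, by simpa using hp⟩

lemma trans (h : ReachIn G A x y) (h' : ReachIn G A y z) : ReachIn G A x z := by
  obtain ⟨p, hp⟩ := h
  obtain ⟨q, hq⟩ := h'
  refine ⟨p.append q, fun v hv => ?_⟩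
  rcases (Walk.mem_support_append_iff p q).1 hv with hv | hv
  exacts [hp v hv, hq v hv]

lemma of_adj (hx : x ∈ A) (hy : y ∈ A) (h : G.Adj x y) : ReachIn G A x y :=
  ⟨h.toWalk, by simp [hx, hy]⟩

lemma mono (hAB : A ⊆ B) (h : ReachIn G A x y) : ReachIn G B x y := by
  obtain ⟨p, hp⟩ := h
  exact ⟨p, fun v hv => hAB (hp v hv)⟩

/-- Reachability inside `A` from reachability in the induced subgraph. -/
lemma of_reachable {X : Set V} {x y : X} (h : (G.induce X).Reachable x y) :
    ReachIn G X x y := by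
  obtain ⟨p⟩ := h
  refine ⟨p.map (Embedding.induce X).toHom, fun v hv => ?_⟩
  obtain ⟨w, -, rfl⟩ := List.mem_map.1 (Walk.support_map _ p ▸ hv)
  exact w.2

/-- Vertices joined inside `A` are joined by a shortest walk inside `A`, which is an
induced path. -/
lemma exists_shortest (h : ReachIn G A x y) :
    ∃ p : G.Walk x y, (∀ v ∈ p.support, v ∈ A) ∧
      (∀ q : G.Walk x y, (∀ v ∈ q.support, v ∈ A) → p.length ≤ q.length) ∧ p.IsPath ∧
      ∀ u v, u ∈ p.support → v ∈ p.support → G.Adj u v → p.toSubgraph.Adj u v := by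
  classical
  have hex : ∃ n, ∃ p : G.Walk x y, (∀ v ∈ p.support, v ∈ A) ∧ p.length = n := by
    obtain ⟨p, hp⟩ := h
    exact ⟨_, p, hp, rfl⟩
  obtain ⟨p, hp, hlen⟩ := Nat.find_spec hex
  have hmin : ∀ q : G.Walk x y, (∀ v ∈ q.support, v ∈ A) → p.length ≤ q.length :=
    fun q hq => hlen ▸ Nat.find_min' hex ⟨q, hq, rfl⟩
  have key : ∀ i j, i < j → j ≤ p.length → G.Adj (p.getVert i) (p.getVert j) → j = i + 1 := by
    intro i j hij hj hadj
    have := hmin ((p.take i).append (.cons hadj (p.drop j))) (fun v hv => by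
      rw [Walk.mem_support_append_iff, Walk.support_cons, List.mem_cons] at hv
      rcases hv with hv | rfl | hv
      · exact hp _ ((p.isSubwalk_take i).support_subset hv)
      · exact hp _ (p.getVert_mem_support i)
      · exact hp _ ((p.isSubwalk_drop j).support_subset hv))
    simp only [Walk.length_append, Walk.take_length, Walk.length_cons, Walk.drop_length] at this
    omega
  refine ⟨p, hp, hmin, ?_, fun u v hu hv hadj => ?_⟩
  · have := hmin p.bypass fun v hv => hp v (p.support_bypass_subset_support hv)
    rw [← p.bypass_eq_self_of_length_le_length_bypass this]
    exact p.bypass_isPath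
  · obtain ⟨i, rfl, hi⟩ := Walk.mem_support_iff_exists_getVert.1 hu
    obtain ⟨j, rfl, hj⟩ := Walk.mem_support_iff_exists_getVert.1 hv
    rcases lt_trichotomy i j with hij | rfl | hij
    · obtain rfl := key i j hij hj hadj
      exact p.toSubgraph_adj_getVert (by omega)
    · exact (G.irrefl hadj).elim
    · obtain rfl := key j i hij hi hadj.symm
      exact (p.toSubgraph_adj_getVert (by omega)).symm

end ReachIn

/-- Reversing a route gives a route. -/
lemma IsRoute.reverse {V : Type} {G : SimpleGraph V} {W S : Set V} {x y : V} {p : G.Walk x y}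
    (h : IsRoute G W S p) : IsRoute G W S p.reverse where
  ne := h.ne.symm
  isPath := h.isPath.reverse
  induced u v hu hv huv := by
    rw [Walk.toSubgraph_reverse]
    exact h.induced u v (by simpa using hu) (by simpa using hv) huv
  support_mem v hv := h.support_mem v (by simpa using hv)
  fst_mem := h.snd_mem
  snd_mem := h.fst_mem
  interior v hv hy hx := h.interior v (by simpa using hv) hx hy

/-- In an ample constellation two vertices of the stable set have no common neighbour. -/
lemma DAmple.eq_of_adj {V : Type} {G : SimpleGraph V} {W S : Set V}
    (hc : IsConstellationOn G W S) (ha : DAmple G W S 1) {v x y : V} (hv : v ∈ W) (hx : x ∈ S)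
    (hy : y ∈ S) (hvx : G.Adj v x) (hvy : G.Adj v y) : x = y := by
  by_contra hne
  have hvS : v ∉ S := fun hv => hc.stable v hv x hx hvx
  have hxy := hc.stable x hx y hy
  have hroute : IsRoute G W S (.cons hvx.symm (.cons hvy .nil) : G.Walk x y) := by
    refine ⟨hne, ?_, ?_, ?_, hx, hy, ?_⟩
    · simp [hne, hvx.ne', hvy.ne]
    · intro u w hu hw huw
      have hyx : ¬ G.Adj y x := fun h => hxy h.symm
      simp only [Walk.support_cons, Walk.support_nil, List.mem_cons, List.not_mem_nil,
        or_false] at hu hw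
      rcases hu with rfl | rfl | rfl <;> rcases hw with rfl | rfl | rfl <;>
        simp_all [Subgraph.sup_adj]
    · intro w hw
      simp only [Walk.support_cons, Walk.support_nil, List.mem_cons, List.not_mem_nil,
        or_false] at hw
      rcases hw with rfl | rfl | rfl
      exacts [hc.subset hx, hv, hc.subset hy]
    · intro w hw h1 h2
      simp only [Walk.support_cons, Walk.support_nil, List.mem_cons, List.not_mem_nil,
        or_false] at hw
      rcases hw with rfl | rfl | rfl
      exacts [(h1 rfl).elim, hvS, (h2 rfl).elim]
  have := ha _ hroute
  simp at this

/-- A set whose vertices in `S` all precede `m` and which contains no neighbour of `m`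
does not join two vertices of `S`. -/
lemma eq_of_reachIn_of_not_adj {V : Type} {G : SimpleGraph V} {S : Set V} {f : V → ℕ}
    (hf : Set.InjOn f S)
    (hi : ∀ x ∈ S, ∀ y ∈ S, ∀ z ∈ S, f x < f y → f y < f z →
      ∀ (p : G.Walk x y), IsRoute G Set.univ S p → ∃ v ∈ p.support, G.Adj z v)
    {A : Set V} {m x y : V} (hm : m ∈ S) (hlt : ∀ s ∈ A, s ∈ S → f s < f m)
    (hadj : ∀ a ∈ A, ¬ G.Adj m a) (hx : x ∈ S) (hy : y ∈ S) (h : ReachIn G A x y) :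
    x = y := by
  classical
  by_contra hne
  have hex : ∃ n, ∃ x y, ∃ p : G.Walk x y, x ∈ S ∧ y ∈ S ∧ f x < f y ∧
      (∀ v ∈ p.support, v ∈ A) ∧ p.length = n := by
    rcases lt_or_gt_of_ne (fun h => hne (hf hx hy h)) with hlt | hlt
    · obtain ⟨p, hp⟩ := h
      exact ⟨_, x, y, p, hx, hy, hlt, hp, rfl⟩
    · obtain ⟨p, hp⟩ := h.symm
      exact ⟨_, y, x, p, hy, hx, hlt, hp, rfl⟩
  obtain ⟨x, y, q, hx, hy, hxy, hq, hlen⟩ := Nat.find_spec hex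
  have hmin : ∀ x' y', ∀ r : G.Walk x' y', x' ∈ S → y' ∈ S → f x' < f y' →
      (∀ v ∈ r.support, v ∈ A) → q.length ≤ r.length :=
    fun x' y' r h1 h2 h3 h4 => hlen ▸ Nat.find_min' hex ⟨x', y', r, h1, h2, h3, h4, rfl⟩
  obtain ⟨p, hp, hpmin, hpath, hind⟩ := ReachIn.exists_shortest ⟨q, hq⟩
  have hpq := hpmin q hq
  have hroute : IsRoute G Set.univ S p := by
    refine ⟨fun h => by simp [h] at hxy, hpath, hind, by simp, hx, hy, fun v hv hvx hvy hvS => ?_⟩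
    by_cases hfv : f x < f v
    · have := hmin _ _ (p.takeUntil v hv) hx hvS hfv
        fun w hw => hp w (p.support_takeUntil_subset_support hv hw)
      have := p.length_takeUntil_lt_length hv hvy
      omega
    · have := hmin _ _ (p.dropUntil v hv) hvS hy (by omega)
        fun w hw => hp w (p.support_dropUntil_subset_support hv hw)
      have := p.length_dropUntil_lt_length hv hvx
      omega
  obtain ⟨v, hv, hmv⟩ := hi x hx y hy m hm hxy (hlt y (hp y p.end_mem_support) hy) p hroute
  exact hadj v (hp v hv) hmv

/-- A component of `G` on `X` containing a vertex of `X`. -/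
lemma exists_compsOn {V : Type} (G : SimpleGraph V) {X : Set V} {v : V} (hv : v ∈ X) :
    ∃ L ∈ CompsOn G X, v ∈ L ∧ ∀ u ∈ X, ReachIn G X v u → u ∈ L := by
  refine ⟨_, ⟨(G.induce X).connectedComponentMk ⟨v, hv⟩, rfl⟩, ⟨⟨v, hv⟩, rfl, rfl⟩, ?_⟩
  rintro u hu ⟨p, hp⟩
  refine ⟨⟨u, hu⟩, ?_, rfl⟩
  exact ConnectedComponent.sound ⟨(p.induce X hp).reverse⟩

lemma IsPathSet.exists_index {V : Type} {G : SimpleGraph V} {P : Set V} (h : IsPathSet G P) :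
    ∃ i : V → ℕ, Set.InjOn i P ∧
      ∀ x ∈ P, ∀ y ∈ P, G.Adj x y → i x + 1 = i y ∨ i y + 1 = i x := by
  classical
  obtain ⟨n, ⟨φ⟩⟩ := h
  refine ⟨fun v => if hv : v ∈ P then (φ ⟨v, hv⟩).val else 0, fun x hx y hy hxy => ?_,
    fun x hx y hy hxy => ?_⟩
  · simp only [hx, hy, dif_pos] at hxy
    simpa using φ.injective (Fin.ext hxy)
  · simp only [hx, hy, dif_pos]
    exact pathGraph_adj.1 (φ.map_adj_iff.2 (by simpa using hxy))

section Constellation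

variable {V : Type} {G : SimpleGraph V} {W S : Set V}

/-- Outside the stable set of a constellation there is no vertex with three neighbours. -/
lemma IsConstellationOn.exists_mem_of_three_adj (hc : IsConstellationOn G W S) {v : V} {a : Fin 3 → V}
    (hv : v ∈ W) (ha : ∀ i, a i ∈ W) (hinj : Function.Injective a) (hadj : ∀ i, G.Adj v (a i)) :
    v ∈ S ∨ ∃ i, a i ∈ S := by
  by_contra! h
  obtain ⟨L, hL, hvL, hL'⟩ := exists_compsOn G (X := W \ S) ⟨hv, h.1⟩
  obtain ⟨i, hi, hia⟩ := (hc.comp_paths L hL).exists_index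
  have haL : ∀ j, a j ∈ L := fun j =>
    hL' _ ⟨ha j, h.2 j⟩ (ReachIn.of_adj ⟨hv, h.1⟩ ⟨ha j, h.2 j⟩ (hadj j))
  have hne : ∀ j k, j ≠ k → i (a j) ≠ i (a k) := fun j k hjk h =>
    hjk (hinj (hi (haL j) (haL k) h))
  have h01 := hne 0 1 (by decide)
  have h02 := hne 0 2 (by decide)
  have h12 := hne 1 2 (by decide)
  have h0 := hia v hvL _ (haL 0) (hadj 0)
  have h1 := hia v hvL _ (haL 1) (hadj 1)
  have h2 := hia v hvL _ (haL 2) (hadj 2)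
  omega

/-- Every triangle of a constellation meets its stable set. -/
lemma IsConstellationOn.exists_mem_of_triangle (hc : IsConstellationOn G W S) {a : Fin 3 → V}
    (ha : ∀ i, a i ∈ W) (hadj : ∀ i j, i ≠ j → G.Adj (a i) (a j)) :
    ∃ i, a i ∈ S := by
  by_contra! h
  have haX : ∀ j, a j ∈ W \ S := fun j => ⟨ha j, h j⟩
  obtain ⟨L, hL, h0L, hL'⟩ := exists_compsOn G (haX 0)
  obtain ⟨i, -, hia⟩ := (hc.comp_paths L hL).exists_index
  have haL : ∀ j, a j ∈ L := fun j => by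
    by_cases hj : j = 0
    · rwa [hj]
    · exact hL' _ (haX j) (ReachIn.of_adj (haX 0) (haX j) (hadj 0 j (Ne.symm hj)))
  have h01 := hia _ (haL 0) _ (haL 1) (hadj 0 1 (by decide))
  have h02 := hia _ (haL 0) _ (haL 2) (hadj 0 2 (by decide))
  have h12 := hia _ (haL 1) _ (haL 2) (hadj 1 2 (by decide))
  omega

end Constellation

section Components

variable {V : Type} {G : SimpleGraph V} {X L L' : Set V} {u v : V}

lemma subset_of_mem_compsOn (hL : L ∈ CompsOn G X) : L ⊆ X := by
  obtain ⟨C, rfl⟩ := hL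
  rintro _ ⟨w, -, rfl⟩
  exact w.2

lemma eq_of_mem_compsOn (hL : L ∈ CompsOn G X) (hL' : L' ∈ CompsOn G X) (h : v ∈ L)
    (h' : v ∈ L') : L = L' := by
  obtain ⟨C, rfl⟩ := hL
  obtain ⟨C', rfl⟩ := hL'
  obtain ⟨w, hw, rfl⟩ := h
  obtain ⟨w', hw', hww⟩ := h'
  obtain rfl := Subtype.ext hww
  rw [ConnectedComponent.mem_supp_iff] at hw hw'
  rw [← hw, ← hw']

lemma mem_of_adj_of_mem_compsOn (hL : L ∈ CompsOn G X) (hu : u ∈ L) (hv : v ∈ X)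
    (h : G.Adj u v) : v ∈ L := by
  obtain ⟨C, rfl⟩ := hL
  obtain ⟨w, hw, rfl⟩ := hu
  refine ⟨⟨v, hv⟩, ?_, rfl⟩
  rw [ConnectedComponent.mem_supp_iff] at hw ⊢
  rw [← hw]
  exact ConnectedComponent.sound (Adj.reachable (G := G.induce X) h.symm)

lemma reachIn_of_mem_compsOn (hL : L ∈ CompsOn G X) (hu : u ∈ L) (hv : v ∈ L) :
    ReachIn G L u v := by
  have hL₀ := hL
  obtain ⟨C, rfl⟩ := hL
  obtain ⟨w, hw, rfl⟩ := hu
  obtain ⟨w', hw', rfl⟩ := hv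
  rw [ConnectedComponent.mem_supp_iff] at hw hw'
  obtain ⟨p, hp⟩ := ReachIn.of_reachable (ConnectedComponent.exact (hw.trans hw'.symm))
  refine ⟨p, fun v hv => ?_⟩
  obtain ⟨M, hM, hwM, hclosed⟩ := exists_compsOn G w.2
  rw [eq_of_mem_compsOn hL₀ hM ⟨w, hw, rfl⟩ hwM]
  classical
  exact hclosed v (hp v hv) ⟨p.takeUntil v hv,
    fun z hz => hp z (p.support_takeUntil_subset_support hv hz)⟩

lemma IsConstellationOn.reachIn {W S : Set V} (hc : IsConstellationOn G W S)
    (hL : L ∈ CompsOn G (W \ S)) {x y : V} (hx : x ∈ S) (hy : y ∈ S) :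
    ReachIn G (L ∪ {x, y}) x y := by
  obtain ⟨x₁, hx₁, hxx₁⟩ := hc.dominates x hx L hL
  obtain ⟨y₁, hy₁, hyy₁⟩ := hc.dominates y hy L hL
  have h1 : ReachIn G (L ∪ {x, y}) x x₁ := .of_adj (.inr (.inl rfl)) (.inl hx₁) hxx₁
  have h2 : ReachIn G (L ∪ {x, y}) y₁ y := .of_adj (.inl hy₁) (.inr (.inr rfl)) hyy₁.symm
  exact (h1.trans ((reachIn_of_mem_compsOn hL hx₁ hy₁).mono Set.subset_union_left)).trans h2

end Components

/-- A vertex outside the stable set of an ample constellation has degree at most three. -/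
lemma ncard_neighborSet_le_three {V : Type} [Finite V] {G : SimpleGraph V} {S : Set V}
    (hc : IsConstellationOn G Set.univ S) (ha : DAmple G Set.univ S 1) {v : V} (hv : v ∉ S) :
    (G.neighborSet v).ncard ≤ 3 := by
  have h1 : (G.neighborSet v ∩ S).ncard ≤ 1 := by
    rw [Set.ncard_le_one]
    rintro x ⟨hx, hxS⟩ y ⟨hy, hyS⟩
    exact ha.eq_of_adj hc (Set.mem_univ v) hxS hyS hx hy
  have h2 : (G.neighborSet v \ S).ncard ≤ 2 := by
    by_contra! h
    obtain ⟨x, y, z, hx, hy, hz, hxy, hxz, hyz⟩ := (Set.two_lt_ncard_iff).1 h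
    rcases hc.exists_mem_of_three_adj (a := ![x, y, z]) (Set.mem_univ v) (by simp)
      (by
        intro i j hij
        fin_cases i <;> fin_cases j <;> simp_all)
      (by
        intro i
        fin_cases i
        exacts [hx.1, hy.1, hz.1]) with h | ⟨i, hi⟩
    · exact hv h
    · fin_cases i
      exacts [hx.2 hi, hy.2 hi, hz.2 hi]
  have := Set.ncard_inter_add_ncard_sdiff_eq_ncard (G.neighborSet v) S
  omega

/-- If all elements of a set lying on one side of `m` leave fewer than `q` elements strictly
between them and `m`, then that side has at most `q` elements. -/
lemma ncard_le_of_between {V : Type} [Finite V] {B : Set V} {g : V → ℕ} (hg : Set.InjOn g B) {q : ℕ}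
    (h : ∀ x ∈ B, {z | z ∈ B ∧ g x < g z}.ncard < q) : B.ncard ≤ q := by
  rcases B.eq_empty_or_nonempty with rfl | hne
  · simp
  obtain ⟨x, hx, hmin⟩ := Set.exists_min_image B g (Set.toFinite _) hne
  have hsub : B \ {x} ⊆ {z | z ∈ B ∧ g x < g z} := fun z hz =>
    ⟨hz.1, lt_of_le_of_ne (hmin z hz.1) fun h => hz.2 (hg hz.1 hx h.symm)⟩
  have h1 := Set.ncard_le_ncard hsub (Set.toFinite _)
  rw [Set.ncard_sdiff_singleton_of_mem hx] at h1
  have := h x hx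
  omega

/-- An ample interrupted constellation has no ample zigzagged constellation with
many more than `2 * q` vertices and at least six paths as an induced subgraph. -/
lemma not_zigzagged_of_interrupted {V : Type} [Finite V] {G : SimpleGraph V} {S : Set V}
    (hc : IsConstellationOn G Set.univ S) (ha : DAmple G Set.univ S 1)
    (hi : Interrupted G Set.univ S) {W' S' : Set V} {q : ℕ}
    (hc' : IsConstellationOn G W' S') (ha' : DAmple G W' S' 1) (hz : Zigzagged G W' S' q)
    (hcard : 2 * q + 3 ≤ S'.ncard) (hcomps : 4 ≤ (CompsOn G (W' \ S')).ncard) : False := by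
  classical
  obtain ⟨f, hf, hi⟩ := hi
  have hS'S : S' ⊆ S := by
    intro x hx
    by_contra hxS
    have h3 := ncard_neighborSet_le_three hc ha hxS
    have : Nonempty V := ⟨x⟩
    choose! nb hnbL hnb using hc'.dominates x hx
    have := Set.ncard_le_ncard_of_injOn (s := CompsOn G (W' \ S')) (t := G.neighborSet x) nb
      (fun L hL => hnb L hL)
      (fun L hL L' hL' h => eq_of_mem_compsOn hL hL' (hnbL L hL) (h ▸ hnbL L' hL'))
    omega
  obtain ⟨a, b, c, haS, hbS, hcS, hab, hac, hbc⟩ :=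
    (Set.two_lt_ncard_iff (s := S')).1 (by omega)
  obtain ⟨m, ⟨hmS, hmW⟩, hmax⟩ := Set.exists_max_image (S ∩ W') f (Set.toFinite _)
    ⟨a, hS'S haS, hc'.subset haS⟩
  have hlt : ∀ s ∈ S, s ∈ W' → s ≠ m → f s < f m := fun s hs hsW hsm =>
    lt_of_le_of_ne (hmax s ⟨hs, hsW⟩) fun h => hsm (hf hs hmS h)
  by_cases hmS' : m ∈ S'
  · obtain ⟨L, hL⟩ : (CompsOn G (W' \ S')).Nonempty := by
      rw [Set.nonempty_iff_ne_empty]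
      intro h
      simp [h] at hcomps
    have hLX := subset_of_mem_compsOn hL
    have hroute : ∀ x ∈ S', x ≠ m → ∃ p : G.Walk x m, IsRoute G W' S' p ∧
        ∀ y ∈ S', y ≠ x → y ≠ m → ¬ ∃ v ∈ p.support, G.Adj y v := by
      intro x hx hxm
      obtain ⟨p, hp, hmin, hpath, hind⟩ := (hc'.reachIn hL hx hmS').exists_shortest
      have hpL : ∀ v ∈ p.support, v ≠ x → v ≠ m → v ∈ L := by
        intro v hv hvx hvm
        rcases hp v hv with h | rfl | rfl
        exacts [h, (hvx rfl).elim, (hvm rfl).elim]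
      have hpW : ∀ v ∈ p.support, v ∈ W' := by
        intro v hv
        rcases hp v hv with h | rfl | rfl
        exacts [(hLX h).1, hc'.subset hx, hmW]
      refine ⟨p, ⟨hxm, hpath, hind, hpW, hx, hmS', fun v hv hvx hvm =>
        (hLX (hpL v hv hvx hvm)).2⟩, ?_⟩
      rintro y hy hyx hym ⟨v, hv, hyv⟩
      have hvx : v ≠ x := fun h => hc'.stable y hy x hx (h ▸ hyv)
      have hvm : v ≠ m := fun h => hc'.stable y hy m hmS' (h ▸ hyv)
      refine hyx (eq_of_reachIn_of_not_adj hf hi (A := {w | w ∈ (p.takeUntil v hv).support} ∪ {y})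
        hmS ?_ ?_ (hS'S hx) (hS'S hy) ?_).symm
      · rintro s (hs | rfl) hsS
        · refine hlt s hsS (hpW s (p.support_takeUntil_subset_support hv hs)) ?_
          rintro rfl
          exact Walk.endpoint_notMem_support_takeUntil hpath hv hvm.symm hs
        · exact hlt s hsS (hc'.subset hy) hym
      · rintro w (hw | rfl) hmw
        · have hwv : w ≠ v := by
            rintro rfl
            exact hym (ha.eq_of_adj hc (Set.mem_univ w) (hS'S hy) hmS hyv.symm hmw.symm)
          have h1 := Walk.length_takeUntil_lt_length hw hwv
          have h2 := Walk.length_takeUntil_lt_length hv hvm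
          have h3 := hmin (((p.takeUntil v hv).takeUntil w hw).concat hmw.symm) (by
            intro z hz
            rw [Walk.support_concat] at hz
            rcases List.mem_append.1 hz with hz | hz
            · exact hp z (p.support_takeUntil_subset_support hv
                (Walk.support_takeUntil_subset_support _ hw hz))
            · simp only [List.mem_singleton] at hz
              exact Or.inr (Or.inr hz))
          rw [Walk.length_concat] at h3
          omega
        · exact hc'.stable m hmS' w hy hmw
      · exact ReachIn.trans ⟨p.takeUntil v hv, fun w hw => Or.inl hw⟩
          (ReachIn.of_adj (Or.inl (Walk.end_mem_support _)) (Or.inr rfl) hyv.symm)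
    obtain ⟨g, hg, hzig⟩ := hz
    have hbelow : {z | z ∈ S' ∧ g z < g m}.ncard ≤ q := by
      refine ncard_le_of_between (g := g) (hg.mono fun z hz => hz.1) ?_
      rintro x ⟨hx, hxm⟩
      obtain ⟨p, hp, hpy⟩ := hroute x hx (by rintro rfl; omega)
      refine lt_of_le_of_lt (Set.ncard_le_ncard ?_ (Set.toFinite _)) (hzig x hx m hmS' hxm p hp)
      rintro z ⟨⟨hz, hzm⟩, hxz⟩
      exact ⟨hz, hxz, hzm, hpy z hz (by rintro rfl; omega) (by rintro rfl; omega)⟩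
    have habove : {z | z ∈ S' ∧ g m < g z}.ncard ≤ q := by
      obtain ⟨N, hN⟩ : ∃ N, ∀ v, g v ≤ N := by
        obtain ⟨N, hN⟩ := (Set.finite_range g).bddAbove
        exact ⟨N, fun v => hN ⟨v, rfl⟩⟩
      refine ncard_le_of_between (g := fun v => N - g v) ?_ ?_
      · intro u hu v hv huv
        have := hN u
        have := hN v
        exact hg hu.1 hv.1 (by simp only at huv; omega)
      rintro x ⟨hx, hxm⟩
      obtain ⟨p, hp, hpy⟩ := hroute x hx (by rintro rfl; omega)
      refine lt_of_le_of_lt (Set.ncard_le_ncard ?_ (Set.toFinite _))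
        (hzig m hmS' x hx hxm p.reverse hp.reverse)
      rintro z ⟨⟨hz, hzm⟩, hxz⟩
      have := hN x
      have := hN z
      refine ⟨hz, hzm, by omega, ?_⟩
      simpa using hpy z hz (by rintro rfl; omega) (by rintro rfl; omega)
    have hsub : S' ⊆ ({z | z ∈ S' ∧ g z < g m} ∪ {z | z ∈ S' ∧ g m < g z}) ∪ {m} := by
      intro z hz
      rcases lt_trichotomy (g z) (g m) with h | h | h
      · exact Or.inl (Or.inl ⟨hz, h⟩)
      · exact Or.inr (hg hz hmS' h)
      · exact Or.inl (Or.inr ⟨hz, h⟩)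
    have h1 := Set.ncard_le_ncard hsub (Set.toFinite _)
    have h2 := Set.ncard_union_le ({z | z ∈ S' ∧ g z < g m} ∪ {z | z ∈ S' ∧ g m < g z}) {m}
    have h3 := Set.ncard_union_le {z | z ∈ S' ∧ g z < g m} {z | z ∈ S' ∧ g m < g z}
    rw [Set.ncard_singleton] at h2
    omega
  · obtain ⟨L, hL, hmL⟩ : ∃ L ∈ CompsOn G (W' \ S'), m ∉ L := by
      by_contra! h
      have : (CompsOn G (W' \ S')).ncard ≤ 1 := by
        rw [Set.ncard_le_one]
        exact fun L hL L' hL' => eq_of_mem_compsOn hL hL' (h L hL) (h L' hL')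
      omega
    have hLX := subset_of_mem_compsOn hL
    obtain ⟨x, y, hx, hy, hxy, hmx, hmy⟩ : ∃ x y, x ∈ S' ∧ y ∈ S' ∧ x ≠ y ∧
        ¬ G.Adj m x ∧ ¬ G.Adj m y := by
      have key : ∀ s ∈ S', ∀ t ∈ S', s ≠ t → G.Adj m s → ¬ G.Adj m t :=
        fun s hs t ht hst hms hmt => hst (ha'.eq_of_adj hc' hmW hs ht hms hmt)
      by_cases h1 : G.Adj m a
      · exact ⟨b, c, hbS, hcS, hbc, key a haS b hbS hab h1, key a haS c hcS hac h1⟩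
      · by_cases h2 : G.Adj m b
        · exact ⟨a, c, haS, hcS, hac, h1, key b hbS c hcS hbc h2⟩
        · exact ⟨a, b, haS, hbS, hab, h1, h2⟩
    refine hxy (eq_of_reachIn_of_not_adj hf hi (A := L ∪ {x, y}) hmS ?_ ?_ (hS'S hx) (hS'S hy)
      (hc'.reachIn hL hx hy))
    · rintro s (hs | rfl | rfl) hsS
      · exact hlt s hsS (hLX hs).1 fun h => hmL (h ▸ hs)
      · exact hlt s hsS (hc'.subset hx) fun h => hmS' (h ▸ hx)
      · exact hlt s hsS (hc'.subset hy) fun h => hmS' (h ▸ hy)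
    · rintro s (hs | rfl | rfl) hms
      · exact hmL (mem_of_adj_of_mem_compsOn hL hs ⟨hmW, hmS'⟩ hms.symm)
      · exact hmx hms
      · exact hmy hms

/-- The vertices of `X` are assigned to edges of `T` (with `R x u v` meaning that `x` is
assigned to `uv`) in the way the vertices of a subdivision of `T`, or of its line graph, are;
moreover the vertices assigned to three edges at a vertex meet `S`. -/
structure EdgeAssignment {V W : Type} (G : SimpleGraph V) (S X : Set V) (T : SimpleGraph W)
    (R : V → W → W → Prop) : Prop where
  mem : ∀ {x u v}, R x u v → x ∈ X
  adj : ∀ {x u v}, R x u v → T.Adj u v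
  symm : ∀ {x u v}, R x u v → R x v u
  cover : ∀ {x y u v}, x ∈ X → G.Adj x y → R y u v → ∃ u' v', R x u' v'
  near : ∀ {x y u v u' v'}, x = y ∨ G.Adj x y → R x u v → R y u' v' →
    ∃ a a', (a = u ∨ a = v) ∧ (a' = u' ∨ a' = v') ∧ (a = a' ∨ T.Adj a a')
  nonempty : ∀ {u v}, T.Adj u v → ∃ x, R x u v
  reach : ∀ {x y u v w}, R x u v → R y v w → ReachIn G {z | R z u v ∨ R z v w} x y
  star : ∀ {w} {a : Fin 3 → W}, Function.Injective a → (∀ i, T.Adj w (a i)) →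
    ∃ s ∈ S, ∃ i, R s w (a i)

/-- The list `l` traces a walk of `T` visiting two claws that are disjoint and
anticomplete; `b 0` and `b' 0` are their centres. -/
def TwoClaws {W : Type} (T : SimpleGraph W) (l : List W) (b b' : Fin 4 → W) : Prop :=
  l.IsChain T.Adj ∧ (∀ i, b i ∈ l) ∧ (∀ i, b' i ∈ l) ∧
    (∀ i j, b i = b j → i = j) ∧ (∀ i j, b' i = b' j → i = j) ∧
    (∀ i : Fin 3, T.Adj (b 0) (b i.succ)) ∧ (∀ i : Fin 3, T.Adj (b' 0) (b' i.succ)) ∧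
    ∀ i j, b i ≠ b' j ∧ ¬ T.Adj (b i) (b' j)

lemma reachIn_of_isChain {W : Type} {T : SimpleGraph W} {l : List W} (hl : l.IsChain T.Adj)
    {u v : W} (hu : u ∈ l) (hv : v ∈ l) : ReachIn T {w | w ∈ l} u v := by
  have key : ∀ (l : List W) (a : W), (a :: l).IsChain T.Adj → ∀ v ∈ a :: l,
      ReachIn T {w | w ∈ a :: l} a v := by
    intro l
    induction l with
    | nil =>
      intro a _ v hv
      obtain rfl := List.mem_singleton.1 hv
      exact .refl hv
    | cons c l ih =>
      intro a hl v hv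
      rw [List.isChain_cons_cons] at hl
      rcases List.mem_cons.1 hv with rfl | hv'
      · exact .refl hv
      · exact (ReachIn.of_adj (A := {w | w ∈ a :: c :: l}) (by simp) (by simp) hl.1).trans
          ((ih c hl.2 v hv').mono fun w hw => List.mem_cons_of_mem a hw)
  match l, hl with
  | [], _ => simp at hu
  | a :: l, hl => exact (key l a hl u hu).symm.trans (key l a hl v hv)

namespace EdgeAssignment

variable {V W : Type} {G : SimpleGraph V} {S X : Set V} {T : SimpleGraph W}
  {R : V → W → W → Prop}

lemma reachIn (h : EdgeAssignment G S X T R) {B : Set W} {u u' : W} (hr : ReachIn T B u u')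
    {x y : V} {v v' : W} (hv : v ∈ B) (hv' : v' ∈ B) (hx : R x v u) (hy : R y u' v') :
    ReachIn G {z | ∃ a ∈ B, ∃ c ∈ B, R z a c} x y := by
  obtain ⟨p, hp⟩ := hr
  induction p generalizing x v with
  | @nil u =>
    refine (h.reach hx hy).mono ?_
    have hu := hp u (by simp)
    rintro z (hz | hz)
    exacts [⟨_, hv, _, hu, hz⟩, ⟨_, hu, _, hv', hz⟩]
  | @cons u c u' huc p ih =>
    have hu := hp u (by simp)
    have hc := hp c (by simp)
    obtain ⟨x', hx'⟩ := h.nonempty huc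
    refine ((h.reach hx hx').mono ?_).trans
      (ih hu hx' hy fun w hw => hp w (by simp [hw]))
    rintro z (hz | hz)
    exacts [⟨_, hv, _, hu, hz⟩, ⟨_, hu, _, hc, hz⟩]

lemma exists_reachIn_of_twoClaws (h : EdgeAssignment G S X T R) {l : List W} {b b' : Fin 4 → W}
    (hl : TwoClaws T l b b') :
    ∃ s ∈ S, ∃ s' ∈ S, s ≠ s' ∧ s ∈ X ∧
      ReachIn G {z | ∃ a ∈ l, ∃ c ∈ l, R z a c} s s' := by
  obtain ⟨hch, hb, hb', hinj, hinj', hadj, hadj', hfar⟩ := hl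
  obtain ⟨s, hs, i, hsi⟩ := h.star (a := fun i => b i.succ)
    (fun i j hij => Fin.succ_injective _ (hinj _ _ hij)) hadj
  obtain ⟨s', hs', j, hsj⟩ := h.star (a := fun i => b' i.succ)
    (fun i j hij => Fin.succ_injective _ (hinj' _ _ hij)) hadj'
  refine ⟨s, hs, s', hs', ?_, h.mem hsi,
    h.reachIn (reachIn_of_isChain hch (hb 0) (hb' 0)) (hb i.succ) (hb' j.succ) (h.symm hsi) hsj⟩
  rintro rfl
  obtain ⟨a, a', ha, ha', haa⟩ := h.near (Or.inl rfl) hsi hsj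
  rcases ha with rfl | rfl <;> rcases ha' with rfl | rfl <;>
    exact haa.elim (hfar _ _).1 (hfar _ _).2

end EdgeAssignment

/-- No graph containing two far apart connected pieces, each visiting two claws, has an edge
assignment inside an ample interrupted constellation. -/
lemma EdgeAssignment.false_of_interrupted {V W : Type} [Finite V] {G : SimpleGraph V}
    {S X : Set V} {T : SimpleGraph W} {R : V → W → W → Prop} (h : EdgeAssignment G S X T R)
    (hi : Interrupted G Set.univ S) {l l' : List W} {b₁ b₂ b₁' b₂' : Fin 4 → W}
    (hl : TwoClaws T l b₁ b₂) (hl' : TwoClaws T l' b₁' b₂') {φ : W → ℕ}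
    (hφ : ∀ a c, T.Adj a c → φ a ≤ φ c + 1) {k : ℕ} (hφl : ∀ a ∈ l, φ a ≤ k)
    (hφl' : ∀ a ∈ l', k + 4 ≤ φ a) : False := by
  obtain ⟨f, hf, hi⟩ := hi
  obtain ⟨s, hs, t, ht, hst, hsX, hr⟩ := h.exists_reachIn_of_twoClaws hl
  obtain ⟨s', hs', t', ht', hst', -, hr'⟩ := h.exists_reachIn_of_twoClaws hl'
  obtain ⟨m, ⟨hmS, hmX⟩, hmax⟩ := Set.exists_max_image (S ∩ X) f (Set.toFinite _) ⟨s, hs, hsX⟩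
  have touch : ∀ {l : List W} {s t : V}, s ∈ S → t ∈ S → s ≠ t →
      ReachIn G {z | ∃ a ∈ l, ∃ c ∈ l, R z a c} s t →
      ∃ z, (∃ a ∈ l, ∃ c ∈ l, R z a c) ∧ (m = z ∨ G.Adj m z) := by
    intro l s t hs ht hst hr
    by_contra! hno
    refine hst (eq_of_reachIn_of_not_adj hf hi hmS ?_ (fun a ha => (hno a ha).2) hs ht hr)
    rintro z ⟨a, ha, c, hc, hz⟩ hzS
    exact lt_of_le_of_ne (hmax z ⟨hzS, h.mem hz⟩) fun hfz =>
      (hno z ⟨a, ha, c, hc, hz⟩).1 (hf hmS hzS hfz.symm)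
  obtain ⟨z, ⟨a, ha, c, hc, hz⟩, hmz⟩ := touch hs ht hst hr
  obtain ⟨z', ⟨a', ha', c', hc', hz'⟩, hmz'⟩ := touch hs' ht' hst' hr'
  obtain ⟨u, v, hm⟩ : ∃ u v, R m u v := by
    rcases hmz with rfl | hmz
    exacts [⟨a, c, hz⟩, h.cover hmX hmz hz]
  obtain ⟨e, e₁, he, he₁, hee⟩ := h.near hmz hm hz
  obtain ⟨d, d₁, hd, hd₁, hdd⟩ := h.near hmz' hm hz'
  have h1 : φ e₁ ≤ k := by rcases he₁ with rfl | rfl <;> exact hφl _ ‹_›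
  have h2 : k + 4 ≤ φ d₁ := by rcases hd₁ with rfl | rfl <;> exact hφl' _ ‹_›
  have h3 : φ e ≤ φ e₁ + 1 := by
    rcases hee with rfl | hee
    exacts [by omega, hφ _ _ hee]
  have h4 : φ d₁ ≤ φ d + 1 := by
    rcases hdd with rfl | hdd
    exacts [by omega, hφ _ _ hdd.symm]
  have h5 : φ d ≤ φ e + 1 := by
    rcases he with rfl | rfl <;> rcases hd with rfl | rfl
    exacts [by omega, hφ _ _ (h.adj hm).symm, hφ _ _ (h.adj hm), by omega]
  omega

lemma ReachIn.map {V U : Type} {G : SimpleGraph V} {H : SimpleGraph U} (F : H →g G) {A : Set U}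
    {x y : U} (h : ReachIn H A x y) : ReachIn G (F '' A) (F x) (F y) := by
  obtain ⟨p, hp⟩ := h
  refine ⟨p.map F, fun v hv => ?_⟩
  obtain ⟨w, hw, rfl⟩ := List.mem_map.1 (Walk.support_map F p ▸ hv)
  exact ⟨w, hp w hw, rfl⟩

lemma reachIn_support {V : Type} {G : SimpleGraph V} {a c x y : V} (p : G.Walk a c)
    (hx : x ∈ p.support) (hy : y ∈ p.support) : ReachIn G {z | z ∈ p.support} x y := by
  classical
  have key : ∀ z ∈ p.support, ReachIn G {z | z ∈ p.support} a z := fun z hz =>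
    ⟨p.takeUntil z hz, fun w hw => p.support_takeUntil_subset_support hz hw⟩
  exact (key x hx).symm.trans (key y hy)

lemma lineGraph_adj {U : Type} {H : SimpleGraph U} {e e' : H.edgeSet} :
    (LineGraph H).Adj e e' ↔ e ≠ e' ∧ ∃ v, v ∈ e.1 ∧ v ∈ e'.1 := by
  rw [LineGraph, fromRel_adj]
  refine and_congr_right fun _ => ⟨?_, Or.inl⟩
  rintro (h | ⟨v, h, h'⟩)
  exacts [h, ⟨v, h', h⟩]

/-- Any two edges of a walk are joined by edges of the walk in the line graph. -/
lemma reachIn_lineGraph_edges {U : Type} {H : SimpleGraph U} {a c : U} (p : H.Walk a c)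
    {e e' : H.edgeSet} (he : e.1 ∈ p.edges) (he' : e'.1 ∈ p.edges) :
    ReachIn (LineGraph H) {z | z.1 ∈ p.edges} e e' := by
  have key : ∀ {a c : U} (p : H.Walk a c) (d : H.edgeSet), a ∈ d.1 → ∀ e : H.edgeSet,
      e.1 ∈ p.edges → ReachIn (LineGraph H) ({z | z.1 ∈ p.edges} ∪ {d}) d e := by
    intro a c p
    induction p with
    | nil => simp
    | @cons a b c hab p ih =>
      intro d hd e he
      let g : H.edgeSet := ⟨s(a, b), hab⟩
      have hdg : ReachIn (LineGraph H) ({z | z.1 ∈ (Walk.cons hab p).edges} ∪ {d}) d g := by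
        by_cases hdg : d = g
        · exact hdg ▸ .refl (Or.inr rfl)
        · exact .of_adj (Or.inr rfl) (Or.inl (by simp [g]))
            (lineGraph_adj.2 ⟨hdg, a, hd, by simp [g]⟩)
      rw [Walk.edges_cons, List.mem_cons] at he
      rcases he with he | he
      · obtain rfl : e = g := Subtype.ext he
        exact hdg
      · refine hdg.trans ((ih g (by simp [g]) e he).mono ?_)
        rintro z (hz | rfl)
        · exact Or.inl (by simpa using Or.inr hz)
        · exact Or.inl (by simp [g])
  match p with
  | .nil => simp at he
  | .cons (v := b) hab p =>
    have hsub : {z : H.edgeSet | z.1 ∈ (Walk.cons hab p).edges} ∪ {⟨s(a, b), hab⟩} ⊆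
        {z | z.1 ∈ (Walk.cons hab p).edges} := by
      rintro z (hz | rfl)
      exacts [hz, by simp]
    have key' := key (Walk.cons hab p) ⟨s(a, b), hab⟩ (by simp)
    exact ((key' e he).mono hsub).symm.trans ((key' e' he').mono hsub)

namespace SubdivModel

variable {U W : Type} {H : SimpleGraph U} {T : SimpleGraph W} {ok : ℕ → Prop}
  (M : SubdivModel H T ok)

lemma exists_common_end {u v u' v' : W} (h : T.Adj u v) (h' : T.Adj u' v') {x : U}
    (hx : x ∈ (M.path h).support) (hx' : x ∈ (M.path h').support) :
    ∃ c, (c = u ∨ c = v) ∧ (c = u' ∨ c = v') := by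
  by_cases hs : (s(u, v) : Sym2 W) = s(u', v')
  · rcases Sym2.eq_iff.1 hs with ⟨rfl, rfl⟩ | ⟨rfl, rfl⟩
    exacts [⟨u, by simp, by simp⟩, ⟨u, by simp, by simp⟩]
  by_contra! hno
  have h1 : x ≠ M.b u := fun hxu =>
    (M.branch_avoid h' u (hxu ▸ hx')).elim (hno u (.inl rfl)).1 (hno u (.inl rfl)).2
  have h2 : x ≠ M.b v := fun hxv =>
    (M.branch_avoid h' v (hxv ▸ hx')).elim (hno v (.inr rfl)).1 (hno v (.inr rfl)).2
  have h3 : x ≠ M.b u' := fun hxu =>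
    (M.branch_avoid h u' (hxu ▸ hx)).elim (fun e => (hno u' (.inl e)).1 rfl)
      fun e => (hno u' (.inr e)).1 rfl
  have h4 : x ≠ M.b v' := fun hxv =>
    (M.branch_avoid h v' (hxv ▸ hx)).elim (fun e => (hno v' (.inl e)).2 rfl)
      fun e => (hno v' (.inr e)).2 rfl
  exact (M.interiors_anticomplete h h' hs x hx h1 h2 x hx' h3 h4).1 rfl

lemma not_nil {u v : W} (h : T.Adj u v) : ¬ (M.path h).Nil :=
  Walk.not_nil_of_ne (M.b_inj.ne h.ne)

lemma snd_ne_snd {w a a' : W} (h : T.Adj w a) (h' : T.Adj w a') (hne : a ≠ a') :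
    (M.path h).snd ≠ (M.path h').snd := by
  intro heq
  have hx := (M.path h).getVert_mem_support 1
  have hx' := (M.path h').getVert_mem_support 1
  have hs : (s(w, a) : Sym2 W) ≠ s(w, a') := fun e => hne (Sym2.congr_right.1 e)
  have h1 : (M.path h).snd ≠ M.b w := (Walk.adj_snd (M.not_nil h)).ne'
  have h2 : (M.path h).snd ≠ M.b a := fun e => by
    have e' : (M.path h').getVert 1 = M.b a := heq.symm.trans e
    rcases M.branch_avoid h' a (e' ▸ hx') with rfl | rfl
    exacts [h.ne rfl, hne rfl]
  have h3 : (M.path h').snd ≠ M.b a' := fun e => by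
    have e' : (M.path h).getVert 1 = M.b a' := heq.trans e
    rcases M.branch_avoid h a' (e' ▸ hx) with rfl | rfl
    exacts [h'.ne rfl, hne rfl]
  exact (M.interiors_anticomplete h h' hs _ hx h1 h2 _ hx' (fun e => h1 (heq.trans e)) h3).1 heq

end SubdivModel

/-- The vertices of a subdivision of `T` are assigned to the edges of `T`. -/
lemma EdgeAssignment.of_subdivision {V W : Type} {G : SimpleGraph V} {S X : Set V}
    {T : SimpleGraph W} {ok : ℕ → Prop} (hc : IsConstellationOn G Set.univ S)
    (M : SubdivModel (G.induce X) T ok) :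
    EdgeAssignment G S X T fun x u v =>
      ∃ (h : T.Adj u v) (hx : x ∈ X), (⟨x, hx⟩ : X) ∈ (M.path h).support where
  mem := fun ⟨_, hx, _⟩ => hx
  adj := fun ⟨h, _⟩ => h
  symm := fun ⟨h, hx, hxp⟩ => ⟨h.symm, hx, by simpa [M.path_symm h] using hxp⟩
  cover := by
    rintro x y _ _ hx hxy ⟨-, hy, -⟩
    obtain ⟨u, v, h, hp⟩ := M.edges_eq ⟨x, hx⟩ ⟨y, hy⟩ hxy
    exact ⟨u, v, h, hx, (Walk.mem_verts_toSubgraph _).1 (Subgraph.edge_vert _ hp)⟩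
  near := by
    rintro x y u v u' v' (rfl | hxy) ⟨h, hx, hxp⟩ ⟨h', hy, hyp⟩
    · obtain ⟨c, hc, hc'⟩ := M.exists_common_end h h' hxp hyp
      exact ⟨c, c, hc, hc', .inl rfl⟩
    · obtain ⟨s, t, hst, hp⟩ := M.edges_eq ⟨x, hx⟩ ⟨y, hy⟩ hxy
      obtain ⟨c, hc, hcs⟩ := M.exists_common_end h hst hxp
        ((Walk.mem_verts_toSubgraph _).1 (Subgraph.edge_vert _ hp))
      obtain ⟨d, hd, hds⟩ := M.exists_common_end h' hst hyp
        ((Walk.mem_verts_toSubgraph _).1 (Subgraph.edge_vert _ hp.symm))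
      refine ⟨c, d, hc, hd, ?_⟩
      rcases hcs with rfl | rfl <;> rcases hds with rfl | rfl
      exacts [.inl rfl, .inr hst, .inr hst.symm, .inl rfl]
  nonempty := fun {u v} h => ⟨M.b u, h, (M.b u).2, (M.path h).start_mem_support⟩
  reach := by
    rintro x y u v w ⟨h, hx, hxp⟩ ⟨h', hy, hyp⟩
    have h1 := (reachIn_support _ hxp (Walk.end_mem_support _)).map (Embedding.induce X).toHom
    have h2 := (reachIn_support _ (Walk.start_mem_support _) hyp).map (Embedding.induce X).toHom
    refine (h1.mono ?_).trans (h2.mono ?_)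
    · rintro _ ⟨z, hz, rfl⟩
      exact Or.inl ⟨h, z.2, hz⟩
    · rintro _ ⟨z, hz, rfl⟩
      exact Or.inr ⟨h', z.2, hz⟩
  star := by
    intro w a ha hwa
    rcases hc.exists_mem_of_three_adj (v := M.b w) (a := fun i => (M.path (hwa i)).snd)
      (Set.mem_univ _) (fun _ => Set.mem_univ _)
      (fun i j hij => by
        by_contra hne
        exact M.snd_ne_snd (hwa i) (hwa j) (ha.ne hne) (Subtype.ext hij))
      (fun i => Walk.adj_snd (M.not_nil (hwa i))) with h | ⟨i, hi⟩
    · exact ⟨_, h, 0, hwa 0, (M.b w).2, Walk.start_mem_support _⟩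
    · exact ⟨_, hi, i, hwa i, Subtype.property _, Walk.getVert_mem_support _ 1⟩

/-- The vertices of the line graph of a subdivision of `T` are assigned to the edges of `T`. -/
lemma EdgeAssignment.of_lineGraph {V U W : Type} {G : SimpleGraph V} {S X : Set V}
    {H : SimpleGraph U} {T : SimpleGraph W} {ok : ℕ → Prop}
    (hc : IsConstellationOn G Set.univ S) (M : SubdivModel H T ok)
    (φ : LineGraph H ≃g G.induce X) :
    EdgeAssignment G S X T fun x u v =>
      ∃ (h : T.Adj u v) (e : H.edgeSet), (φ e : V) = x ∧ e.1 ∈ (M.path h).edges where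
  mem := by
    rintro _ u v ⟨h, e, rfl, he⟩
    exact (φ e).2
  adj := fun ⟨h, _⟩ => h
  symm := fun ⟨h, e, hx, he⟩ => ⟨h.symm, e, hx, by simpa [M.path_symm h] using he⟩
  cover := by
    rintro x - - - hx - -
    obtain ⟨e, he⟩ := φ.surjective ⟨x, hx⟩
    obtain ⟨⟨a, c⟩, hac⟩ := e
    obtain ⟨u, v, h, hp⟩ := M.edges_eq a c hac
    exact ⟨u, v, h, _, congrArg Subtype.val he, Walk.adj_toSubgraph_iff_mem_edges.1 hp⟩
  near := by
    rintro _ _ u v u' v' hxy ⟨h, e, rfl, he⟩ ⟨h', e', rfl, he'⟩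
    obtain ⟨x, hx, hx'⟩ : ∃ x, x ∈ e.1 ∧ x ∈ e'.1 := by
      rcases hxy with hxy | hxy
      · obtain rfl := φ.injective (Subtype.ext hxy)
        exact ⟨_, Sym2.out_fst_mem _, Sym2.out_fst_mem _⟩
      · exact (lineGraph_adj.1 (φ.map_adj_iff.1 hxy)).2
    obtain ⟨c, hc, hc'⟩ := M.exists_common_end h h'
      (Walk.mem_support_of_mem_edges he hx) (Walk.mem_support_of_mem_edges he' hx')
    exact ⟨c, c, hc, hc', .inl rfl⟩
  nonempty := fun {u v} h => ⟨_, h, ⟨s(M.b u, (M.path h).snd), Walk.adj_snd (M.not_nil h)⟩, rfl,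
    Walk.mk_start_snd_mem_edges (M.not_nil h)⟩
  reach := by
    rintro _ _ u v w ⟨h, e, rfl, he⟩ ⟨h', e', rfl, he'⟩
    have := ((reachIn_lineGraph_edges ((M.path h).append (M.path h')) (e := e) (e' := e')
      (by simp [he]) (by simp [he'])).map φ.toEmbedding.toHom).map (Embedding.induce X).toHom
    refine this.mono ?_
    rintro _ ⟨_, ⟨z, hz, rfl⟩, rfl⟩
    rcases List.mem_append.1 (Walk.edges_append _ _ ▸ hz) with hz | hz
    exacts [Or.inl ⟨h, z, rfl, hz⟩, Or.inr ⟨h', z, rfl, hz⟩]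
  star := by
    intro w a ha hwa
    let e : Fin 3 → H.edgeSet := fun i =>
      ⟨s(M.b w, (M.path (hwa i)).snd), Walk.adj_snd (M.not_nil (hwa i))⟩
    obtain ⟨i, hi⟩ := hc.exists_mem_of_triangle (a := fun i => (φ (e i) : V))
      (fun _ => Set.mem_univ _) (fun i j hij => by
        refine φ.map_adj_iff.2 (lineGraph_adj.2 ⟨fun hee => ?_, M.b w, by simp [e], by simp [e]⟩)
        have := congrArg Subtype.val hee
        simp only [e, Sym2.congr_right] at this
        exact M.snd_ne_snd (hwa i) (hwa j) (ha.ne hij) this)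
    exact ⟨_, hi, i, hwa i, e i, rfl, Walk.mk_start_snd_mem_edges (M.not_nil (hwa i))⟩

/-- An ample interrupted constellation contains neither a subdivision of a graph with two far
apart pieces, each visiting two claws, nor the line graph of such a subdivision. -/
lemma no_subdivision_of_twoClaws {V W : Type} [Finite V] {G : SimpleGraph V} {S : Set V}
    (hc : IsConstellationOn G Set.univ S) (hi : Interrupted G Set.univ S) {T : SimpleGraph W}
    {ok : ℕ → Prop} {l l' : List W} {b₁ b₂ b₁' b₂' : Fin 4 → W}
    (hl : TwoClaws T l b₁ b₂) (hl' : TwoClaws T l' b₁' b₂') {φ : W → ℕ}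
    (hφ : ∀ a c, T.Adj a c → φ a ≤ φ c + 1) {k : ℕ} (hφl : ∀ a ∈ l, φ a ≤ k)
    (hφl' : ∀ a ∈ l', k + 4 ≤ φ a) :
    (¬ ∃ X : Set V, IsSubdivisionWith (G.induce X) T ok) ∧
    (¬ ∃ (m : ℕ) (S' : SimpleGraph (Fin m)),
        IsSubdivisionWith S' T ok ∧ HasInducedSubgraphIso G (LineGraph S')) := by
  constructor
  · rintro ⟨X, ⟨M⟩⟩
    exact (EdgeAssignment.of_subdivision hc M).false_of_interrupted hi hl hl' hφ hφl hφl'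
  · rintro ⟨m, H, ⟨M⟩, X, ⟨ψ⟩⟩
    exact (EdgeAssignment.of_lineGraph hc M ψ).false_of_interrupted hi hl hl' hφ hφl hφl'

instance (r : ℕ) : DecidableRel (Wall r).Adj :=
  fun a b => decidable_of_iff _ (SimpleGraph.fromRel_adj _ a b).symm

instance (r : ℕ) : DecidableRel (BinTree r).Adj :=
  fun a b => decidable_of_iff _ (SimpleGraph.fromRel_adj _ a b).symm

instance {W : Type} [DecidableEq W] (T : SimpleGraph W) [DecidableRel T.Adj] (l : List W)
    (b b' : Fin 4 → W) : Decidable (TwoClaws T l b b') := by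
  unfold TwoClaws
  infer_instance

lemma twoClaws_wall_left : TwoClaws (Wall 6)
    [(1, 0), (1, 1), (1, 2), (1, 1), (2, 1), (2, 2), (3, 2), (3, 3), (4, 3), (4, 2), (5, 2),
      (5, 1), (5, 2), (5, 3)]
    ![(1, 1), (1, 0), (1, 2), (2, 1)] ![(5, 2), (4, 2), (5, 1), (5, 3)] := by
  decide +kernel

lemma twoClaws_wall_right : TwoClaws (Wall 6)
    [(1, 8), (1, 9), (1, 10), (1, 9), (2, 9), (2, 10), (3, 10), (3, 11), (4, 11), (4, 10),
      (5, 10), (5, 9), (5, 10), (5, 11)]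
    ![(1, 9), (1, 8), (1, 10), (2, 9)] ![(5, 10), (4, 10), (5, 9), (5, 11)] := by
  decide +kernel

lemma wall_column_le {r : ℕ} (a c : Fin r × Fin (2 * r)) (h : (Wall r).Adj a c) :
    a.2.val ≤ c.2.val + 1 := by
  obtain ⟨-, (h | h) | (h | h)⟩ := (SimpleGraph.fromRel_adj _ a c).1 h
  · omega
  · have := congrArg Fin.val h.1
    omega
  · omega
  · have := congrArg Fin.val h.1
    omega

instance : NeZero (2 ^ (7 + 1) - 1) := ⟨by decide⟩

lemma twoClaws_binTree_left : TwoClaws (BinTree 7)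
    [31, 15, 32, 15, 7, 3, 8, 18, 37, 18, 38]
    ![15, 7, 31, 32] ![18, 8, 37, 38] := by
  decide +kernel

lemma twoClaws_binTree_right : TwoClaws (BinTree 7)
    [55, 27, 56, 27, 13, 6, 14, 30, 61, 30, 62]
    ![27, 13, 55, 56] ![30, 14, 61, 62] := by
  decide +kernel

/-- A function on the vertices of a full binary tree, numbered from `1`, which changes by at
most one along edges and separates the leftmost from the rightmost subtree at depth two. -/
def treeHeight (n : ℕ) : ℕ :=
  if n = 1 then 2 else if n = 2 then 1 else if n = 3 then 3 else
    match n / 2 ^ (Nat.log2 n - 2) with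
    | 4 => 0
    | 5 => 1
    | 6 => 3
    | _ => 4

lemma treeHeight_child : ∀ n < 128, 1 ≤ n → ∀ i < 2,
    treeHeight n ≤ treeHeight (2 * n + i) + 1 ∧ treeHeight (2 * n + i) ≤ treeHeight n + 1 := by
  decide +kernel

lemma treeHeight_le (a c : Fin (2 ^ (7 + 1) - 1)) (h : (BinTree 7).Adj a c) :
    treeHeight (a.val + 1) ≤ treeHeight (c.val + 1) + 1 := by
  have ha : a.val < 255 := a.2
  have hc : c.val < 255 := c.2
  obtain ⟨-, (h | h) | (h | h)⟩ := (SimpleGraph.fromRel_adj _ a c).1 h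
  · exact h ▸ (treeHeight_child (a.val + 1) (by omega) (by omega) 0 (by omega)).1
  · exact h ▸ (treeHeight_child (a.val + 1) (by omega) (by omega) 1 (by omega)).1
  · exact h ▸ (treeHeight_child (c.val + 1) (by omega) (by omega) 0 (by omega)).2
  · exact h ▸ (treeHeight_child (c.val + 1) (by omega) (by omega) 1 (by omega)).2

/-- Theorem 8.1: an ample interrupted constellation has no induced
subgraph isomorphic to: an ample `q`-zigzagged `(3q+6, 6·C(q+2,3))`-constellation for
any positive `q`; a subdivision of `T_7` or its line graph; a subdivision of `W_{6×6}`
or its line graph. -/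
theorem stmt14 {V : Type} [Fintype V] (G : SimpleGraph V) (S : Set V)
    (hc : IsConstellationOn G Set.univ S)
    (ha : DAmple G Set.univ S 1)
    (hi : Interrupted G Set.univ S) :
    (∀ q : ℕ, 0 < q →
      ¬ ∃ W' S' : Set V, IsConstellationOn G W' S' ∧ DAmple G W' S' 1 ∧
          Zigzagged G W' S' q ∧ S'.ncard = 3 * q + 6 ∧
          (CompsOn G (W' \ S')).ncard = 6 * Nat.choose (q + 2) 3) ∧
    (¬ ∃ X : Set V, IsSubdivisionWith (G.induce X) (BinTree 7) (fun n => 1 ≤ n)) ∧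
    (¬ ∃ (m : ℕ) (S' : SimpleGraph (Fin m)),
        IsSubdivisionWith S' (BinTree 7) (fun n => 1 ≤ n) ∧
        HasInducedSubgraphIso G (LineGraph S')) ∧
    (¬ ∃ X : Set V, IsSubdivisionWith (G.induce X) (Wall 6) (fun n => 1 ≤ n)) ∧
    (¬ ∃ (m : ℕ) (S' : SimpleGraph (Fin m)),
        IsSubdivisionWith S' (Wall 6) (fun n => 1 ≤ n) ∧
        HasInducedSubgraphIso G (LineGraph S')) := by
  have hT := no_subdivision_of_twoClaws (ok := fun n => 1 ≤ n) hc hi twoClaws_binTree_left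
    twoClaws_binTree_right treeHeight_le (k := 0) (by decide +kernel) (by decide +kernel)
  have hW := no_subdivision_of_twoClaws (ok := fun n => 1 ≤ n) hc hi twoClaws_wall_left
    twoClaws_wall_right wall_column_le (k := 3) (by decide +kernel) (by decide +kernel)
  refine ⟨?_, hT.1, hT.2, hW.1, hW.2⟩
  rintro q hq ⟨W', S', hc', ha', hz, hS', hL⟩
  have := Nat.choose_pos (show 3 ≤ q + 2 by omega)
  exact not_zigzagged_of_interrupted hc ha hi hc' ha' hz (by omega) (by omega)
end

section
/- Let w be a positive integer, let H be a graph of pathwidth at most w, and let G be a subdivision of a leaf-extension of H. Then the pathwidth of G is at most 2w² + 3w + 2. -/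
open SimpleGraph

/-- Thicken a sequence of bags on `W` to a path decomposition of `G`: the vertices outside
`b '' W` are enumerated by `key` so that adjacent ones are consecutive, the bag of index `i`
is repeated `M` times, and two consecutive enumerated vertices are added to each copy. -/
lemma pathwidthLE_of_key {W U : Type} [Finite W] {G : SimpleGraph U}
    {w n M : ℕ} (hM : 0 < M) (B : Fin n → Set W)
    (hcov : ∀ a, ∃ i, a ∈ B i)
    (hconv : ∀ (v : W) (i j k : Fin n), i ≤ j → j ≤ k → v ∈ B i → v ∈ B k → v ∈ B j)
    (hcard : ∀ i, (B i).ncard ≤ w + 1)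
    (b : W → U) (hb : Function.Injective b) (key : U → ℕ)
    (key_inj : Set.InjOn key (Set.range b)ᶜ)
    (key_lt : ∀ x ∉ Set.range b, key x < n * M)
    (key_adj : ∀ x ∉ Set.range b, ∀ y ∉ Set.range b, G.Adj x y →
      key x = key y + 1 ∨ key y = key x + 1)
    (adj_key : ∀ a, ∀ x ∉ Set.range b, G.Adj (b a) x →
      ∃ i : Fin n, (i : ℕ) = key x / M ∧ a ∈ B i)
    (adj_branch : ∀ a a', G.Adj (b a) (b a') → ∃ i, a ∈ B i ∧ a' ∈ B i) :
    PathwidthLE G (w + 2) := by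
  have hdiv (t : Fin (n * M)) : (t : ℕ) / M < n :=
    Nat.div_lt_of_lt_mul (t.2.trans_eq (mul_comm n M))
  let extra (t : ℕ) : Set U := {x | x ∉ Set.range b ∧ (key x = t ∨ key x = t + 1)}
  have base (i : Fin n) : ∃ t : Fin (n * M), (⟨(t : ℕ) / M, hdiv t⟩ : Fin n) = i :=
    ⟨⟨i * M, Nat.mul_lt_mul_of_pos_right i.2 hM⟩,
      Fin.ext (Nat.mul_div_cancel _ hM)⟩
  have extra_card (t : ℕ) : (extra t).ncard ≤ 2 := by
    have hinj : Set.InjOn key (extra t) := key_inj.mono fun x hx => hx.1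
    rw [← hinj.ncard_image]
    refine (Set.ncard_le_ncard (t := {t, t + 1}) ?_ (Set.toFinite _)).trans
      (Set.ncard_pair (by omega)).le
    rintro _ ⟨x, hx, rfl⟩
    simpa using hx.2
  have mixed (a : W) (x : U) (hx : x ∉ Set.range b) (h : G.Adj (b a) x) :
      ∃ t : Fin (n * M), b a ∈ b '' B ⟨(t : ℕ) / M, hdiv t⟩ ∪ extra t ∧
        x ∈ b '' B ⟨(t : ℕ) / M, hdiv t⟩ ∪ extra t := by
    obtain ⟨i, hi, ha⟩ := adj_key a x hx h
    refine ⟨⟨key x, key_lt x hx⟩, Or.inl ⟨a, ?_, rfl⟩, Or.inr ⟨hx, Or.inl rfl⟩⟩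
    convert ha
    exact hi.symm
  refine ⟨n * M, fun t => b '' B ⟨(t : ℕ) / M, hdiv t⟩ ∪ extra t, ?_, ?_, ?_, ?_⟩
  · intro x
    by_cases hx : x ∈ Set.range b
    · obtain ⟨a, rfl⟩ := hx
      obtain ⟨i, hi⟩ := hcov a
      obtain ⟨t, rfl⟩ := base i
      exact ⟨t, Or.inl ⟨a, hi, rfl⟩⟩
    · exact ⟨⟨key x, key_lt x hx⟩, Or.inr ⟨hx, Or.inl rfl⟩⟩
  · intro x y hxy
    by_cases hx : x ∈ Set.range b <;> by_cases hy : y ∈ Set.range b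
    · obtain ⟨a, rfl⟩ := hx
      obtain ⟨a', rfl⟩ := hy
      obtain ⟨i, hi, hi'⟩ := adj_branch a a' hxy
      obtain ⟨t, rfl⟩ := base i
      exact ⟨t, Or.inl ⟨a, hi, rfl⟩, Or.inl ⟨a', hi', rfl⟩⟩
    · obtain ⟨a, rfl⟩ := hx
      exact mixed a y hy hxy
    · obtain ⟨a, rfl⟩ := hy
      obtain ⟨t, h₁, h₂⟩ := mixed a x hx hxy.symm
      exact ⟨t, h₂, h₁⟩
    · rcases key_adj x hx y hy hxy with h | h
      · exact ⟨⟨key y, key_lt y hy⟩, Or.inr ⟨hx, Or.inr h⟩, Or.inr ⟨hy, Or.inl rfl⟩⟩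
      · exact ⟨⟨key x, key_lt x hx⟩, Or.inr ⟨hx, Or.inl rfl⟩, Or.inr ⟨hy, Or.inr h⟩⟩
  · rintro x i j k hij hjk (⟨a, ha, rfl⟩ | hi) (⟨a', ha', hk'⟩ | hk)
    · obtain rfl := hb hk'
      exact Or.inl ⟨a', hconv a' _ _ _ (Nat.div_le_div_right (c := M) hij)
        (Nat.div_le_div_right (c := M) hjk) ha ha', rfl⟩
    · exact absurd ⟨a, rfl⟩ hk.1
    · exact absurd ⟨a', hk'⟩ hi.1
    · refine Or.inr ⟨hi.1, ?_⟩
      have := hi.2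
      have := hk.2
      have : (i : ℕ) ≤ j := hij
      have : (j : ℕ) ≤ k := hjk
      omega
  · intro t
    refine (Set.ncard_union_le _ _).trans ?_
    have h₁ : (b '' B ⟨(t : ℕ) / M, hdiv t⟩).ncard ≤ w + 1 :=
      (Set.ncard_image_le (Set.toFinite _)).trans (hcard _)
    have h₂ := extra_card t
    omega

lemma leafExt_adj_inl_inl {W L : Type} {H : SimpleGraph W} {f : L → W} {a a' : W} :
    (leafExt H L f).Adj (Sum.inl a) (Sum.inl a') ↔ H.Adj a a' := by
  simp only [leafExt, SimpleGraph.fromRel_adj, H.adj_comm a' a, or_self, ne_eq, Sum.inl.injEq]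
  exact ⟨fun h => h.2, fun h => ⟨h.ne, h⟩⟩

lemma leafExt_adj_inl_inr {W L : Type} {H : SimpleGraph W} {f : L → W} {a : W} {l : L} :
    (leafExt H L f).Adj (Sum.inl a) (Sum.inr l) ↔ f l = a := by
  simp [leafExt]

lemma leafExt_not_adj_inr_inr {W L : Type} {H : SimpleGraph W} {f : L → W} {l l' : L} :
    ¬ (leafExt H L f).Adj (Sum.inr l) (Sum.inr l') := by
  simp [leafExt]

/-- A leaf lies on only one edge of a leaf-extension. -/
lemma leafExt_edge_eq_of_inr_mem {W L : Type} {H : SimpleGraph W} {f : L → W} {l : L}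
    {e : Sym2 (W ⊕ L)} (he : e ∈ (leafExt H L f).edgeSet) (hl : Sum.inr l ∈ e) :
    e = s(Sum.inl (f l), Sum.inr l) := by
  obtain ⟨v, rfl⟩ := Sym2.mem_iff_exists.mp hl
  rw [SimpleGraph.mem_edgeSet] at he
  cases v with
  | inl a => rw [leafExt_adj_inl_inr.mp he.symm, Sym2.eq_swap]
  | inr l' => exact absurd he leafExt_not_adj_inr_inr

/-- The ends in `W` of an edge of a leaf-extension lie in a common bag. -/
lemma exists_bag_of_mem_leafExt_edgeSet {W L : Type} {H : SimpleGraph W} {f : L → W} {n : ℕ}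
    {B : Fin n → Set W} (hcov : ∀ a, ∃ i, a ∈ B i)
    (hedge : ∀ u v, H.Adj u v → ∃ i, u ∈ B i ∧ v ∈ B i)
    {e : Sym2 (W ⊕ L)} (he : e ∈ (leafExt H L f).edgeSet) :
    ∃ i, ∀ a, Sum.inl a ∈ e → a ∈ B i := by
  by_cases hl : ∃ l, Sum.inr l ∈ e
  · obtain ⟨l, hl⟩ := hl
    obtain ⟨i, hi⟩ := hcov (f l)
    refine ⟨i, fun a ha => ?_⟩
    rw [leafExt_edge_eq_of_inr_mem he hl] at ha
    simp only [Sym2.mem_iff, Sum.inl.injEq, reduceCtorEq, or_false] at ha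
    rwa [ha]
  · induction e with
    | _ u v =>
      cases u with
      | inr l => exact absurd ⟨l, Sym2.mem_mk_left _ _⟩ hl
      | inl a =>
        cases v with
        | inr l => exact absurd ⟨l, Sym2.mem_mk_right _ _⟩ hl
        | inl a' =>
          obtain ⟨i, hi, hi'⟩ := hedge a a' ((leafExt_adj_inl_inl (f := f)).mp he)
          refine ⟨i, fun c hc => ?_⟩
          simp only [Sym2.mem_iff, Sum.inl.injEq] at hc
          rcases hc with rfl | rfl <;> assumption

namespace SubdivModel

/-- The path of a subdivision replacing a given edge can be traversed in a fixed direction. -/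
lemma exists_walk {U W : Type} {G : SimpleGraph U} {K : SimpleGraph W} {ok : ℕ → Prop}
    (m : SubdivModel G K ok) (e : K.edgeSet) :
    ∃ (x y : U) (p : G.Walk x y), p.IsPath ∧
      (∀ c, m.b c ∈ p.support → c ∈ (e : Sym2 W)) ∧
      (∀ c ∈ (e : Sym2 W), m.b c ∈ p.support) ∧
      (∀ (u v : W) (h : K.Adj u v), (e : Sym2 W) = s(u, v) →
        (m.path h).toSubgraph = p.toSubgraph) := by
  obtain ⟨e, he⟩ := e
  induction e with
  | _ u v =>
    refine ⟨_, _, m.path he, m.path_isPath he, ?_, ?_, ?_⟩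
    · intro c hc
      exact Sym2.mem_iff.mpr (m.branch_avoid he c hc)
    · intro c hc
      rcases Sym2.mem_iff.mp hc with rfl | rfl
      · exact Walk.start_mem_support _
      · exact Walk.end_mem_support _
    · intro u' v' h huv
      rcases Sym2.eq_iff.mp huv with ⟨rfl, rfl⟩ | ⟨rfl, rfl⟩
      · rfl
      · rw [m.path_symm he, Walk.toSubgraph_reverse]

/-- Paths of a subdivision that share a non-branch vertex replace the same edge. -/
lemma edge_eq_of_mem {U W : Type} {G : SimpleGraph U} {K : SimpleGraph W} {ok : ℕ → Prop}
    (m : SubdivModel G K ok) {u v u' v' : W} (h : K.Adj u v) (h' : K.Adj u' v') {x : U}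
    (hx : x ∉ Set.range m.b) (hp : x ∈ (m.path h).support) (hp' : x ∈ (m.path h').support) :
    s(u, v) = s(u', v') := by
  by_contra hne
  have hxb (c : W) : x ≠ m.b c := fun hc => hx ⟨c, hc.symm⟩
  exact (m.interiors_anticomplete h h' hne x hp (hxb _) (hxb _) x hp' (hxb _) (hxb _)).1 rfl

/-- A subdivision of a leaf-extension of `H` has pathwidth at most two more than `H`. -/
lemma pathwidthLE_leafExt {U W L : Type} [Finite U] [Finite W] [Finite L] {H : SimpleGraph W}
    {G : SimpleGraph U} {f : L → W} {ok : ℕ → Prop} {w : ℕ}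
    (m : SubdivModel G (leafExt H L f) ok) (hH : PathwidthLE H w) :
    PathwidthLE G (w + 2) := by
  obtain ⟨n, B, hcov, hedge, hconv, hcard⟩ := hH
  have := Fintype.ofFinite U
  set K := leafExt H L f
  choose s t P hP hPb hbP hPsub using m.exists_walk
  choose I hI using fun e : K.edgeSet => exists_bag_of_mem_leafExt_edgeSet hcov hedge e.2
  have hPsupp (u v : W ⊕ L) (h : K.Adj u v) (x : U) :
      x ∈ (m.path h).support ↔ x ∈ (P ⟨s(u, v), h⟩).support := by
    rw [← Walk.mem_verts_toSubgraph, ← Walk.mem_verts_toSubgraph, hPsub ⟨s(u, v), h⟩ u v h rfl]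
  let b : W → U := fun a => m.b (Sum.inl a)
  have hb : Function.Injective b := m.b_inj.comp Sum.inl_injective
  have cover (x : U) (hx : x ∉ Set.range b) : ∃ e, x ∈ (P e).support := by
    rcases m.cover x with ⟨a | l, rfl⟩ | ⟨u, v, h, hxp⟩
    · exact absurd ⟨a, rfl⟩ hx
    · have h : K.Adj (Sum.inl (f l)) (Sum.inr l) := leafExt_adj_inl_inr.mpr rfl
      exact ⟨⟨s(Sum.inl (f l), Sum.inr l), h⟩, hbP ⟨_, h⟩ _ (Sym2.mem_mk_right _ _)⟩
    · exact ⟨_, (hPsupp u v h x).mp hxp⟩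
  have unique (x : U) (hx : x ∉ Set.range b) (e e' : K.edgeSet)
      (h : x ∈ (P e).support) (h' : x ∈ (P e').support) : e = e' := by
    by_cases hxb : x ∈ Set.range m.b
    · obtain ⟨a | l, rfl⟩ := hxb
      · exact absurd ⟨a, rfl⟩ hx
      · apply Subtype.ext
        rw [leafExt_edge_eq_of_inr_mem e.2 (hPb _ _ h),
          leafExt_edge_eq_of_inr_mem e'.2 (hPb _ _ h')]
    · obtain ⟨e, he⟩ := e
      obtain ⟨e', he'⟩ := e'
      induction e with
      | _ u v =>
        induction e' with
        | _ u' v' =>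
          exact Subtype.ext (m.edge_eq_of_mem he he' hxb ((hPsupp u v he x).mpr h)
            ((hPsupp u' v' he' x).mpr h'))
  have on_path (x y : U) (h : G.Adj x y) : ∃ e, (P e).toSubgraph.Adj x y := by
    obtain ⟨u, v, huv, hadj⟩ := m.edges_eq x y h
    exact ⟨⟨s(u, v), huv⟩, by rwa [← hPsub ⟨s(u, v), huv⟩ u v huv rfl]⟩
  have locate (x : U) : ∃ (q : Option K.edgeSet × ℕ), x ∉ Set.range b →
      ∃ e, q.1 = some e ∧ (P e).getVert q.2 = x ∧ q.2 ≤ (P e).length := by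
    by_cases hx : x ∈ Set.range b
    · exact ⟨(none, 0), fun h => absurd hx h⟩
    · obtain ⟨e, he⟩ := cover x hx
      obtain ⟨i, hi, hil⟩ := Walk.mem_support_iff_exists_getVert.mp he
      exact ⟨(some e, i), fun _ => ⟨e, rfl, hi, hil⟩⟩
  choose loc hloc using locate
  obtain ⟨E, ⟨c⟩⟩ := Finite.exists_equiv_fin K.edgeSet
  let N := Fintype.card U
  let M := E * N + 1
  let q : K.edgeSet → ℕ → ℕ := fun e i => I e * M + (c e * N + i)
  have hlen (e : K.edgeSet) {i : ℕ} (hi : i ≤ (P e).length) : i < N :=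
    hi.trans_lt (hP e).length_lt
  have hinner (e : K.edgeSet) {i : ℕ} (hi : i ≤ (P e).length) : c e * N + i < M := by
    have h₁ := hlen e hi
    have h₂ : ((c e : ℕ) + 1) * N ≤ E * N := Nat.mul_le_mul_right _ (c e).2
    rw [add_mul] at h₂
    omega
  let key : U → ℕ := fun x => (loc x).1.elim 0 fun e => q e (loc x).2
  have key_eq (x : U) (hx : x ∉ Set.range b) (e : K.edgeSet) (i : ℕ)
      (hi : i ≤ (P e).length) (hxi : (P e).getVert i = x) : key x = q e i := by
    obtain ⟨e', h₁, h₂, h₃⟩ := hloc x hx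
    have hmem : x ∈ (P e).support := hxi ▸ Walk.getVert_mem_support _ _
    have hmem' : x ∈ (P e').support := by
      have h := Walk.getVert_mem_support (P e') (loc x).2
      rwa [h₂] at h
    obtain rfl := unique x hx e e' hmem hmem'
    have hii := (hP e).getVert_injOn h₃ hi (h₂.trans hxi.symm)
    simp [key, h₁, hii]
  have exists_pos (x : U) (hx : x ∉ Set.range b) :
      ∃ e, ∃ i ≤ (P e).length, (P e).getVert i = x ∧ key x = q e i := by
    obtain ⟨e, -, h₂, h₃⟩ := hloc x hx
    exact ⟨e, _, h₃, h₂, key_eq x hx e _ h₃ h₂⟩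
  have q_div (e : K.edgeSet) {i : ℕ} (hi : i ≤ (P e).length) : q e i / M = I e := by
    have h := hinner e hi
    simp only [q]
    rw [mul_comm, Nat.mul_add_div (by omega), Nat.div_eq_of_lt h, add_zero]
  refine pathwidthLE_of_key (M := M) (Nat.succ_pos _) B hcov hconv hcard b hb key ?_ ?_ ?_ ?_ ?_
  · intro x hx y hy hxy
    obtain ⟨e, i, hi, rfl, hk⟩ := exists_pos x hx
    obtain ⟨e', i', hi', rfl, hk'⟩ := exists_pos y hy
    have hq : q e i = q e' i' := by rw [← hk, ← hk']; exact hxy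
    have hI : (I e : ℕ) = I e' := by rw [← q_div e hi, ← q_div e' hi', hq]
    have hinn : (c e : ℕ) * N + i = c e' * N + i' := by
      simp only [q, hI] at hq
      omega
    have hc : (c e : ℕ) = c e' := by
      have h := congrArg (· / N) hinn
      have h₁ := hlen e hi
      have h₂ := hlen e' hi'
      simp only [mul_comm _ N] at h
      rwa [Nat.mul_add_div (by omega), Nat.mul_add_div (by omega), Nat.div_eq_of_lt h₁,
        Nat.div_eq_of_lt h₂] at h
    obtain rfl := c.injective (Fin.ext hc)
    obtain rfl : i = i' := by omega
    rfl
  · intro x hx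
    obtain ⟨e, i, hi, -, hk⟩ := exists_pos x hx
    have h := hinner e hi
    have h₂ : ((I e : ℕ) + 1) * M ≤ n * M := Nat.mul_le_mul_right _ (I e).2
    rw [add_mul] at h₂
    simp only [hk, q]
    omega
  · intro x hx y hy hxy
    obtain ⟨e, he⟩ := on_path x y hxy
    obtain ⟨i, hi, hil⟩ := Walk.toSubgraph_adj_iff _ |>.mp he
    rcases Sym2.eq_iff.mp hi with ⟨h₁, h₂⟩ | ⟨h₁, h₂⟩
    · rw [key_eq x hx e i hil.le h₁, key_eq y hy e (i + 1) hil h₂]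
      exact Or.inr rfl
    · rw [key_eq y hy e i hil.le h₁, key_eq x hx e (i + 1) hil h₂]
      exact Or.inl rfl
  · intro a x hx hax
    obtain ⟨e, he⟩ := on_path _ _ hax
    have ha := (Walk.mem_verts_toSubgraph _).mp he.fst_mem
    obtain ⟨i, hi, hil⟩ := Walk.mem_support_iff_exists_getVert.mp
      ((Walk.mem_verts_toSubgraph _).mp he.snd_mem)
    exact ⟨I e, by rw [key_eq x hx e i hil hi, q_div e hil], hI e a (hPb e _ ha)⟩
  · intro a a' haa
    obtain ⟨e, he⟩ := on_path _ _ haa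
    exact ⟨I e, hI e a (hPb e _ ((Walk.mem_verts_toSubgraph _).mp he.fst_mem)),
      hI e a' (hPb e _ ((Walk.mem_verts_toSubgraph _).mp he.snd_mem))⟩

end SubdivModel

lemma PathwidthLE.mono {V : Type} {G : SimpleGraph V} {k l : ℕ} (hkl : k ≤ l)
    (h : PathwidthLE G k) : PathwidthLE G l := by
  obtain ⟨n, bag, hcov, hedge, hconv, hcard⟩ := h
  exact ⟨n, bag, hcov, hedge, hconv, fun i => (hcard i).trans (by omega)⟩

/-- Lemma 8.8: if `H` has pathwidth at most `w` and `G` is a subdivision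
of a leaf-extension of `H`, then `G` has pathwidth at most `2w² + 3w + 2`. -/
theorem stmt19 (w : ℕ) (hw : 0 < w) {W U : Type} [Fintype W] [Fintype U]
    (H : SimpleGraph W) (G : SimpleGraph U)
    (hH : PathwidthLE H w)
    (hG : ∃ (L : Type) (_ : Fintype L) (f : L → W),
        IsSubdivisionWith G (leafExt H L f) (fun n => 1 ≤ n)) :
    PathwidthLE G (2 * w ^ 2 + 3 * w + 2) := by
  obtain ⟨L, _, f, ⟨m⟩⟩ := hG
  exact (m.pathwidthLE_leafExt hH).mono (by nlinarith [Nat.zero_le (w ^ 2)])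
end
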